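/- Let n ≥ 1 and W = S_{n+1}, and let I, J ⊆ R. Then the posets (X⁻_{I,J}, ≤) and (X⁺_{I,J}, ≤), each with the restriction of the Bruhat order, are order-isomorphic; an isomorphism is given by sending each w ∈ X⁻_{I,J} to the unique element of maximal length in the double coset W_I w W_J (which lies in X⁺_{I,J}). -/

import Mathlib

/-- The number of inversions (Coxeter length) of a permutation of `Fin m`. -/
def sLen {m : ℕ} (w : Equiv.Perm (Fin m)) : ℕ :=
  (Finset.univ.filter fun p : Fin m × Fin m => p.1 < p.2 ∧ w p.2 < w p.1).card

/-- The Bruhat order on the symmetric group: generated by `w < t * w` for a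
transposition `t` with `sLen (t * w) > sLen w`. -/
def bruhatLE {m : ℕ} (u v : Equiv.Perm (Fin m)) : Prop :=
  Relation.ReflTransGen
    (fun x y => (∃ a b : Fin m, a ≠ b ∧ y = Equiv.swap a b * x) ∧ sLen x < sLen y) u v

/-- The right descent set of `w`, as a set of indices of simple reflections:
`i : Fin n` stands for the simple transposition `s_{i+1} = (i+1, i+2)` (1-based). -/
def Des {n : ℕ} (w : Equiv.Perm (Fin (n + 1))) : Set (Fin n) :=
  {i | w i.succ < w i.castSucc}

/-- Maximal-length double-coset representatives:
`X⁺_{I,J} = {w : I ⊆ Des (w⁻¹) ∧ J ⊆ Des w}`. -/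
def Xplus {n : ℕ} (I J : Set (Fin n)) : Set (Equiv.Perm (Fin (n + 1))) :=
  {w | I ⊆ Des w⁻¹ ∧ J ⊆ Des w}

/-- A subset of the symmetric group is totally ordered (a chain) in Bruhat order. -/
def IsChainOn {m : ℕ} (X : Set (Equiv.Perm (Fin m))) : Prop :=
  ∀ x ∈ X, ∀ y ∈ X, bruhatLE x y ∨ bruhatLE y x

/-- A subset of the symmetric group, with the restriction of the Bruhat order,
is a lattice: every pair has a least upper bound and a greatest lower bound in the set. -/
def IsLatticeOn {m : ℕ} (X : Set (Equiv.Perm (Fin m))) : Prop :=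
  (∀ x ∈ X, ∀ y ∈ X, ∃ z ∈ X, bruhatLE x z ∧ bruhatLE y z ∧
      ∀ t ∈ X, bruhatLE x t → bruhatLE y t → bruhatLE z t) ∧
  (∀ x ∈ X, ∀ y ∈ X, ∃ z ∈ X, bruhatLE z x ∧ bruhatLE z y ∧
      ∀ t ∈ X, bruhatLE t x → bruhatLE t y → bruhatLE t z)

/-- `y` covers `x` in the restriction of the Bruhat order to `X`. -/
def CoversIn {m : ℕ} (X : Set (Equiv.Perm (Fin m))) (x y : Equiv.Perm (Fin m)) : Prop :=
  x ∈ X ∧ y ∈ X ∧ bruhatLE x y ∧ x ≠ y ∧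
    ∀ z ∈ X, bruhatLE x z → bruhatLE z y → z = x ∨ z = y

/-- Minimal-length double-coset representatives:
`X⁻_{I,J} = {w : I ⊆ Asc (w⁻¹) ∧ J ⊆ Asc w}`, where `Asc w = R − Des w`. -/
def Xminus {n : ℕ} (I J : Set (Fin n)) : Set (Equiv.Perm (Fin (n + 1))) :=
  {w | I ⊆ (Des w⁻¹)ᶜ ∧ J ⊆ (Des w)ᶜ}

/-- The parabolic subgroup `W_I` generated by the simple reflections indexed by `I`. -/
def parabolic {n : ℕ} (I : Set (Fin n)) : Subgroup (Equiv.Perm (Fin (n + 1))) :=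
  Subgroup.closure ((fun i : Fin n => Equiv.swap i.castSucc i.succ) '' I)

open Equiv

section Bruhat

variable {m : ℕ}

/-- A generating relation of the Bruhat order, expressed through positions rather than lengths. -/
def BruhatStep (x y : Perm (Fin m)) : Prop :=
  ∃ i j : Fin m, i < j ∧ x i < x j ∧ y = x * swap i j

theorem sLen_lt_mul_swap (x : Perm (Fin m)) {i j : Fin m} (hij : i < j) (hx : x i < x j) :
    sLen x < sLen (x * swap i j) := by
  classical
  let g : Fin m × Fin m → Fin m × Fin m := fun p =>
    if swap i j p.1 < swap i j p.2 then (swap i j p.1, swap i j p.2) else p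
  unfold sLen
  rw [← Finset.card_image_of_injOn (f := g)]
  · apply Finset.card_lt_card
    refine Finset.ssubset_iff_subset_ne.2 ⟨?_, ?_⟩
    · refine Finset.image_subset_iff.2 fun ⟨p, q⟩ hp => ?_
      simp only [Finset.mem_filter, Finset.mem_univ, true_and] at hp ⊢
      obtain ⟨hpq, hxpq⟩ := hp
      by_cases h : swap i j p < swap i j q
      · simpa [g, h] using hxpq
      · simp only [g, h, if_false, Perm.mul_apply]
        refine ⟨hpq, ?_⟩
        simp only [swap_apply_def] at h ⊢
        grind
    · intro h
      have hm : (i, j) ∈ Finset.univ.filter fun p : Fin m × Fin m =>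
          p.1 < p.2 ∧ (x * swap i j) p.2 < (x * swap i j) p.1 := by
        exact Finset.mem_filter.2 ⟨Finset.mem_univ _, by simpa using ⟨hij, hx⟩⟩
      rw [← h] at hm
      obtain ⟨⟨p, q⟩, hp, he⟩ := Finset.mem_image.1 hm
      simp only [Finset.mem_filter, Finset.mem_univ, true_and] at hp
      simp only [g] at he
      simp only [swap_apply_def] at he
      grind
  · rintro ⟨p, q⟩ hp ⟨p', q'⟩ hp' he
    simp only [Finset.coe_filter, Finset.mem_univ, true_and, Set.mem_ofPred_eq] at hp hp'
    simp only [g] at he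
    have h1 := swap_apply_eq_iff (x := i) (y := j) (z := p) (w := p')
    have h2 := swap_apply_eq_iff (x := i) (y := j) (z := q) (w := q')
    have h3 := (swap i j).injective.eq_iff (a := p) (b := p')
    have h4 := (swap i j).injective.eq_iff (a := q) (b := q')
    grind

theorem BruhatStep.sLen_lt {x y : Perm (Fin m)} (h : BruhatStep x y) : sLen x < sLen y := by
  obtain ⟨i, j, hij, hx, rfl⟩ := h
  exact sLen_lt_mul_swap x hij hx

theorem BruhatStep.inv {x y : Perm (Fin m)} (h : BruhatStep x y) : BruhatStep x⁻¹ y⁻¹ := by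
  obtain ⟨i, j, hij, hx, rfl⟩ := h
  exact ⟨x i, x j, hx, by simpa using hij, by
    rw [mul_inv_rev, swap_inv, mul_swap_eq_swap_mul]; simp⟩

theorem bruhatStep_mul_swap {x : Perm (Fin m)} {i j : Fin m} (hij : i ≠ j)
    (h : sLen x < sLen (x * swap i j)) : BruhatStep x (x * swap i j) := by
  wlog hlt : i < j generalizing i j
  · rw [swap_comm] at h ⊢
    exact this hij.symm h (lt_of_le_of_ne (not_lt.1 hlt) hij.symm)
  refine ⟨i, j, hlt, lt_of_not_ge fun hle => ?_, rfl⟩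
  have hlt' : x j < x i := lt_of_le_of_ne hle fun he => hij (x.injective he).symm
  have := sLen_lt_mul_swap (x * swap i j) hlt (by simpa using hlt')
  rw [mul_assoc, swap_mul_self, mul_one] at this
  exact this.not_gt h

theorem bruhatLE_iff_reflTransGen {u v : Perm (Fin m)} :
    bruhatLE u v ↔ Relation.ReflTransGen BruhatStep u v := by
  unfold bruhatLE
  refine iff_of_eq (congrArg (fun r => Relation.ReflTransGen r u v) ?_)
  funext x y
  refine propext ⟨?_, fun h => ⟨?_, h.sLen_lt⟩⟩
  · rintro ⟨⟨a, b, hab, rfl⟩, hlt⟩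
    rw [swap_mul_eq_mul_swap] at hlt ⊢
    exact bruhatStep_mul_swap (fun he => hab (x⁻¹.injective he)) hlt
  · obtain ⟨i, j, hij, -, rfl⟩ := h
    exact ⟨x i, x j, fun he => hij.ne (x.injective he), mul_swap_eq_swap_mul ..⟩

theorem BruhatStep.bruhatLE {u v : Perm (Fin m)} (h : BruhatStep u v) : bruhatLE u v :=
  bruhatLE_iff_reflTransGen.2 (.single h)

theorem bruhatLE_refl (u : Perm (Fin m)) : bruhatLE u u := Relation.ReflTransGen.refl

theorem bruhatLE.trans {u v w : Perm (Fin m)} (h : bruhatLE u v) (h' : bruhatLE v w) :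
    bruhatLE u w :=
  Relation.ReflTransGen.trans h h'

theorem bruhatLE.inv {u v : Perm (Fin m)} (h : bruhatLE u v) : bruhatLE u⁻¹ v⁻¹ := by
  rw [bruhatLE_iff_reflTransGen] at h ⊢
  induction h with
  | refl => exact .refl
  | tail _ hs ih => exact ih.tail hs.inv

theorem bruhatLE.eq_or_sLen_lt {u v : Perm (Fin m)} (h : bruhatLE u v) :
    u = v ∨ sLen u < sLen v := by
  induction h with
  | refl => exact .inl rfl
  | tail _ h ih => exact .inr (ih.elim (fun e => e ▸ h.2) fun hlt => hlt.trans h.2)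

theorem bruhatLE.antisymm {u v : Perm (Fin m)} (h : bruhatLE u v) (h' : bruhatLE v u) : u = v := by
  rcases h.eq_or_sLen_lt with e | hlt
  · exact e
  · exact h'.eq_or_sLen_lt.elim Eq.symm fun hgt => absurd hgt hlt.not_gt

end Bruhat

section Lifting

variable {n : ℕ}

/-- The simple transposition exchanging `i` and `i + 1`. -/
def simpleSwap (i : Fin n) : Perm (Fin (n + 1)) := swap i.castSucc i.succ

theorem simpleSwap_mul_self (i : Fin n) : simpleSwap i * simpleSwap i = 1 := swap_mul_self _ _

theorem simpleSwap_inv (i : Fin n) : (simpleSwap i)⁻¹ = simpleSwap i := swap_inv _ _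

theorem simpleSwap_lt {i : Fin n} {a b : Fin (n + 1)} (hab : a < b)
    (h : ¬(a = i.castSucc ∧ b = i.succ)) : simpleSwap i a < simpleSwap i b := by
  simp only [simpleSwap, swap_apply_def]
  rw [Fin.ext_iff, Fin.ext_iff] at h
  split_ifs <;> simp only [Fin.ext_iff, Fin.lt_def, Fin.val_castSucc, Fin.val_succ] at * <;> omega

theorem BruhatStep.mul_simpleSwap {x y : Perm (Fin (n + 1))} (h : BruhatStep x y) (i : Fin n) :
    y = x * simpleSwap i ∨ BruhatStep (x * simpleSwap i) (y * simpleSwap i) := by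
  obtain ⟨a, b, hab, hx, rfl⟩ := h
  by_cases h : a = i.castSucc ∧ b = i.succ
  · exact .inl (by rw [h.1, h.2, simpleSwap])
  · refine .inr ⟨simpleSwap i a, simpleSwap i b, simpleSwap_lt hab h, ?_, ?_⟩
    · simpa [simpleSwap] using hx
    · rw [mul_assoc, mul_assoc, swap_mul_eq_mul_swap, simpleSwap_inv]

theorem bruhatStep_mul_simpleSwap_of_notMem_Des {x : Perm (Fin (n + 1))} {i : Fin n}
    (h : i ∉ Des x) : BruhatStep x (x * simpleSwap i) :=
  ⟨i.castSucc, i.succ, Fin.castSucc_lt_succ,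
    lt_of_le_of_ne (not_lt.1 h) fun e => (Fin.castSucc_lt_succ (i := i)).ne (x.injective e), rfl⟩

theorem bruhatStep_of_mem_Des {x : Perm (Fin (n + 1))} {i : Fin n}
    (h : i ∈ Des x) : BruhatStep (x * simpleSwap i) x :=
  ⟨i.castSucc, i.succ, Fin.castSucc_lt_succ, by
      simp only [simpleSwap, Perm.mul_apply, swap_apply_left, swap_apply_right]
      exact h,
    by rw [mul_assoc, simpleSwap, swap_mul_self, mul_one]⟩

theorem bruhatLE.mul_simpleSwap_left {u v : Perm (Fin (n + 1))} (h : bruhatLE u v) {i : Fin n}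
    (hi : i ∈ Des v) : bruhatLE (u * simpleSwap i) v := by
  rw [bruhatLE_iff_reflTransGen] at h
  induction h using Relation.ReflTransGen.head_induction_on with
  | refl => exact (bruhatStep_of_mem_Des hi).bruhatLE
  | head hs h ih =>
    rcases hs.mul_simpleSwap i with rfl | hs'
    · exact bruhatLE_iff_reflTransGen.2 h
    · exact hs'.bruhatLE.trans ih

theorem bruhatLE.mul_simpleSwap_right {u v : Perm (Fin (n + 1))} (h : bruhatLE u v) {i : Fin n}
    (hi : i ∉ Des u) : bruhatLE u (v * simpleSwap i) := by
  rw [bruhatLE_iff_reflTransGen] at h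
  induction h with
  | refl => exact (bruhatStep_mul_simpleSwap_of_notMem_Des hi).bruhatLE
  | tail h hs ih =>
    rcases hs.mul_simpleSwap i with rfl | hs'
    · rw [mul_assoc, simpleSwap_mul_self, mul_one]
      exact bruhatLE_iff_reflTransGen.2 h
    · exact ih.trans hs'.bruhatLE

theorem bruhatLE.simpleSwap_mul_left {u v : Perm (Fin (n + 1))} (h : bruhatLE u v) {i : Fin n}
    (hi : i ∈ Des v⁻¹) : bruhatLE (simpleSwap i * u) v := by
  simpa [mul_inv_rev, simpleSwap_inv] using (h.inv.mul_simpleSwap_left hi).inv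

theorem bruhatLE.simpleSwap_mul_right {u v : Perm (Fin (n + 1))} (h : bruhatLE u v) {i : Fin n}
    (hi : i ∉ Des u⁻¹) : bruhatLE u (simpleSwap i * v) := by
  simpa [mul_inv_rev, simpleSwap_inv] using (h.inv.mul_simpleSwap_right hi).inv

end Lifting

section DoubleCoset

variable {n : ℕ} {I J : Set (Fin n)}

theorem simpleSwap_mem_parabolic {i : Fin n} (hi : i ∈ I) : simpleSwap i ∈ parabolic I :=
  Subgroup.subset_closure ⟨i, hi, rfl⟩

theorem parabolic_induction {P : Perm (Fin (n + 1)) → Prop}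
    (hI : ∀ i ∈ I, ∀ x, P x → P (simpleSwap i * x))
    (hJ : ∀ i ∈ J, ∀ x, P x → P (x * simpleSwap i))
    {u v w : Perm (Fin (n + 1))} (hu : u ∈ parabolic I) (hv : v ∈ parabolic J) (hw : P w) :
    P (u * w * v) := by
  have hl : ∀ x, P x ↔ P (u * x) := by
    induction hu using Subgroup.closure_induction with
    | mem _ h =>
      obtain ⟨i, hi, rfl⟩ := h
      refine fun x => ⟨hI i hi x, fun h => ?_⟩
      have := hI i hi _ h
      rwa [← mul_assoc, simpleSwap, swap_mul_self, one_mul] at this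
    | one => simp
    | mul a b _ _ ha hb => exact fun x => by rw [hb, ha, mul_assoc]
    | inv a _ ha => exact fun x => by rw [ha (a⁻¹ * x), mul_inv_cancel_left]
  have hr : ∀ x, P x ↔ P (x * v) := by
    induction hv using Subgroup.closure_induction with
    | mem _ h =>
      obtain ⟨i, hi, rfl⟩ := h
      refine fun x => ⟨hJ i hi x, fun h => ?_⟩
      have := hJ i hi _ h
      rwa [mul_assoc, simpleSwap, swap_mul_self, mul_one] at this
    | one => simp
    | mul a b _ _ ha hb => exact fun x => by rw [ha, hb, mul_assoc]
    | inv a _ ha => exact fun x => by rw [ha (x * a⁻¹), inv_mul_cancel_right]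
  exact (hr _).1 ((hl _).1 hw)

/-- `x` lies in the double coset of `w` for the parabolic subgroups of `I` and `J`. -/
def InDoubleCoset (I J : Set (Fin n)) (w x : Perm (Fin (n + 1))) : Prop :=
  ∃ u ∈ parabolic I, ∃ v ∈ parabolic J, x = u * w * v

theorem InDoubleCoset.refl (w : Perm (Fin (n + 1))) : InDoubleCoset I J w w :=
  ⟨1, one_mem _, 1, one_mem _, by simp⟩

theorem InDoubleCoset.symm {w x : Perm (Fin (n + 1))} (h : InDoubleCoset I J w x) :
    InDoubleCoset I J x w := by
  obtain ⟨u, hu, v, hv, rfl⟩ := h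
  exact ⟨u⁻¹, inv_mem hu, v⁻¹, inv_mem hv, by group⟩

theorem InDoubleCoset.trans {w x y : Perm (Fin (n + 1))} (h : InDoubleCoset I J w x)
    (h' : InDoubleCoset I J x y) : InDoubleCoset I J w y := by
  obtain ⟨u, hu, v, hv, rfl⟩ := h
  obtain ⟨u', hu', v', hv', rfl⟩ := h'
  exact ⟨u' * u, mul_mem hu' hu, v * v', mul_mem hv hv', by group⟩

theorem InDoubleCoset.mul_simpleSwap {w x : Perm (Fin (n + 1))} (h : InDoubleCoset I J w x)
    {i : Fin n} (hi : i ∈ J) : InDoubleCoset I J w (x * simpleSwap i) :=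
  h.trans ⟨1, one_mem _, _, simpleSwap_mem_parabolic hi, by simp⟩

theorem InDoubleCoset.simpleSwap_mul {w x : Perm (Fin (n + 1))} (h : InDoubleCoset I J w x)
    {i : Fin n} (hi : i ∈ I) : InDoubleCoset I J w (simpleSwap i * x) :=
  h.trans ⟨_, simpleSwap_mem_parabolic hi, 1, one_mem _, by simp⟩

theorem InDoubleCoset.bruhatLE_of_mem_Xplus {w x y : Perm (Fin (n + 1))}
    (h : InDoubleCoset I J w x) (hy : y ∈ Xplus I J) (hw : bruhatLE w y) : bruhatLE x y := by
  obtain ⟨u, hu, v, hv, rfl⟩ := h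
  exact parabolic_induction (P := fun x => bruhatLE x y)
    (fun i hi x hx => hx.simpleSwap_mul_left (hy.1 hi))
    (fun i hi x hx => hx.mul_simpleSwap_left (hy.2 hi)) hu hv hw

theorem InDoubleCoset.bruhatLE_of_mem_Xminus {w x y : Perm (Fin (n + 1))}
    (h : InDoubleCoset I J w x) (hy : y ∈ Xminus I J) (hw : bruhatLE y w) : bruhatLE y x := by
  obtain ⟨u, hu, v, hv, rfl⟩ := h
  exact parabolic_induction (P := fun x => bruhatLE y x)
    (fun i hi x hx => hx.simpleSwap_mul_right (hy.1 hi))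
    (fun i hi x hx => hx.mul_simpleSwap_right (hy.2 hi)) hu hv hw

theorem exists_inDoubleCoset_mem_Xplus (I J : Set (Fin n)) (w : Perm (Fin (n + 1))) :
    ∃ x, InDoubleCoset I J w x ∧ x ∈ Xplus I J := by
  obtain ⟨x, hx, hmax⟩ := Set.exists_max_image {x | InDoubleCoset I J w x} sLen
    (Set.toFinite _) ⟨w, .refl w⟩
  refine ⟨x, hx, fun i hi => ?_, fun i hi => ?_⟩ <;> by_contra hd
  · have h := (bruhatStep_mul_simpleSwap_of_notMem_Des hd).inv.sLen_lt
    rw [mul_inv_rev, inv_inv, simpleSwap_inv] at h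
    exact (hmax _ (InDoubleCoset.simpleSwap_mul hx hi)).not_gt h
  · exact (hmax _ (InDoubleCoset.mul_simpleSwap hx hi)).not_gt
      (bruhatStep_mul_simpleSwap_of_notMem_Des hd).sLen_lt

theorem exists_inDoubleCoset_mem_Xminus (I J : Set (Fin n)) (w : Perm (Fin (n + 1))) :
    ∃ x, InDoubleCoset I J w x ∧ x ∈ Xminus I J := by
  obtain ⟨x, hx, hmin⟩ := Set.exists_min_image {x | InDoubleCoset I J w x} sLen
    (Set.toFinite _) ⟨w, .refl w⟩
  refine ⟨x, hx, fun i hi hd => ?_, fun i hi hd => ?_⟩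
  · have h := (bruhatStep_of_mem_Des hd).inv.sLen_lt
    rw [mul_inv_rev, inv_inv, simpleSwap_inv] at h
    exact (hmin _ (InDoubleCoset.simpleSwap_mul hx hi)).not_gt h
  · exact (hmin _ (InDoubleCoset.mul_simpleSwap hx hi)).not_gt (bruhatStep_of_mem_Des hd).sLen_lt

end DoubleCoset

/-- The posets `X⁻_{I,J}` and `X⁺_{I,J}` (Bruhat order) are order-isomorphic, an
isomorphism being given by sending `w ∈ X⁻_{I,J}` to the unique maximal-length
element of the double coset `W_I w W_J` (which lies in `X⁺_{I,J}`). -/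
theorem stmt_17 (n : ℕ) (hn : 1 ≤ n) (I J : Set (Fin n)) :
    ∃ f : Equiv.Perm (Fin (n + 1)) → Equiv.Perm (Fin (n + 1)),
      (∀ w ∈ Xminus I J,
        f w ∈ Xplus I J ∧
        (∃ u ∈ parabolic I, ∃ v ∈ parabolic J, f w = u * w * v) ∧
        (∀ x : Equiv.Perm (Fin (n + 1)),
          (∃ u ∈ parabolic I, ∃ v ∈ parabolic J, x = u * w * v) →
            x ≠ f w → sLen x < sLen (f w))) ∧
      Set.BijOn f (Xminus I J) (Xplus I J) ∧
      (∀ u ∈ Xminus I J, ∀ v ∈ Xminus I J,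
        (bruhatLE u v ↔ bruhatLE (f u) (f v))) := by
  choose f hf hfX using exists_inDoubleCoset_mem_Xplus I J
  have hle : ∀ w, bruhatLE w (f w) := fun w =>
    (hf w).symm.bruhatLE_of_mem_Xplus (hfX w) (bruhatLE_refl _)
  have hrefl : ∀ u ∈ Xminus I J, ∀ v, bruhatLE (f u) (f v) → bruhatLE u v := fun u hu v h =>
    (hf v).symm.bruhatLE_of_mem_Xminus hu ((hle u).trans h)
  refine ⟨f, fun w _ => ⟨hfX w, hf w, fun x hx hne => ?_⟩, ⟨fun w _ => hfX w, ?_, ?_⟩,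
    fun u hu v _ => ⟨fun h => ?_, hrefl u hu v⟩⟩
  · exact ((InDoubleCoset.bruhatLE_of_mem_Xplus hx (hfX w) (hle w)).eq_or_sLen_lt).resolve_left hne
  · intro u hu v hv h
    exact (hrefl u hu v (h ▸ bruhatLE_refl _)).antisymm (hrefl v hv u (h ▸ bruhatLE_refl _))
  · intro y hy
    obtain ⟨w, hw, hwX⟩ := exists_inDoubleCoset_mem_Xminus I J y
    have hc := hw.trans (hf w)
    exact ⟨w, hwX, (hc.bruhatLE_of_mem_Xplus hy (bruhatLE_refl _)).antisymm
      (hc.symm.bruhatLE_of_mem_Xplus (hfX w) (bruhatLE_refl _))⟩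
  · exact (hf u).bruhatLE_of_mem_Xplus (hfX v) (h.trans (hle v))
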